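/- (Rellich–Kondrachov-type criterion) Let Ω be a metric space with a finite Borel measure μ such that h(r) := inf{μ(B_r(ω)) : ω ∈ Ω} > 0 for every r > 0. Then every bounded sequence {f_k} ⊂ L^p(μ,Ω) with 1 ≤ p < ∞ satisfying sup_k ∫_Ω |f_k(ω) − (f_k)_{B_r(ω)}|^p dμ(ω) → 0 as r → 0 is relatively compact in L^p(μ,Ω). -/

import Mathlib

open MeasureTheory Set Filter

theorem aux_sc {Ω : Type*} [MetricSpace Ω] [MeasurableSpace Ω] [BorelSpace Ω]
    (μ : Measure Ω) [IsFiniteMeasure μ]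
    (hμ : ∀ r : ℝ, 0 < r → ∃ h > 0, ∀ ω : Ω, h ≤ (μ (Metric.ball ω r)).toReal) :
    SecondCountableTopology Ω := by
  apply Metric.secondCountable_of_almost_dense_set
  intro ε hε
  obtain ⟨u, -, hu, hc⟩ := Vitali.exists_disjoint_subfamily_covering_enlargement_closedBall
    (univ : Set Ω) id (fun _ => ε / 5) (ε / 5) (fun _ _ => le_rfl) 5 (by norm_num)
  refine ⟨u, ?_, ?_⟩
  · obtain ⟨h, h0, hh⟩ := hμ (ε / 5) (by positivity)
    have := Measure.countable_meas_pos_of_disjoint_iUnion (μ := μ) (ι := u)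
      (As := fun i => Metric.closedBall (i : Ω) (ε / 5))
      (fun i => Metric.isClosed_closedBall.measurableSet)
      (fun i j hij => hu i.2 j.2 (fun h => hij (Subtype.ext h)))
    have h2 : {i : u | 0 < μ (Metric.closedBall (i : Ω) (ε / 5))} = univ := by
      ext i
      simp only [mem_ofPred_eq, mem_univ, iff_true]
      refine lt_of_lt_of_le ?_ (measure_mono Metric.ball_subset_closedBall)
      exact (ENNReal.toReal_pos_iff.1 (h0.trans_le (hh i))).1
    rw [h2] at this
    exact countable_coe_iff.1 (countable_univ_iff.1 this)
  · intro x
    obtain ⟨b, hb, hb2⟩ := hc x (mem_univ x)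
    refine ⟨b, hb, ?_⟩
    have := hb2 (Metric.mem_closedBall_self (by positivity))
    rw [Metric.mem_closedBall] at this
    simpa [mul_div_cancel₀] using this

theorem aux_avg_meas {Ω : Type*} [MetricSpace Ω] [MeasurableSpace Ω] [BorelSpace Ω]
    [SecondCountableTopology Ω]
    (μ : Measure Ω) [IsFiniteMeasure μ] (f : Ω → ℝ) (hf : Measurable f) (r : ℝ) :
    Measurable (fun ω => ⨍ ω' in Metric.ball ω r, f ω' ∂μ) := by
  have key : ∀ g : Ω → ℝ, Measurable g → Measurable (fun ω => ∫ ω' in Metric.ball ω r, g ω' ∂μ) := by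
    intro g hg
    have hS : MeasurableSet {q : Ω × Ω | dist q.2 q.1 < r} :=
      (isOpen_lt (by fun_prop) (by fun_prop)).measurableSet
    have : StronglyMeasurable (fun q : Ω × Ω => {q : Ω × Ω | dist q.2 q.1 < r}.indicator (fun q => g q.2) q) :=
      ((hg.comp measurable_snd).indicator hS).stronglyMeasurable
    have h2 := (this.integral_prod_right' (ν := μ)).measurable
    convert h2 using 1
    funext ω
    rw [← integral_indicator Metric.isOpen_ball.measurableSet]
    rfl
  simp_rw [setAverage_eq, smul_eq_mul]
  refine Measurable.mul (Measurable.inv ?_) (key f hf)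
  have := key (fun _ => 1) measurable_const
  simpa using this

theorem aux_avg_bdd {Ω : Type*} [MetricSpace Ω] [MeasurableSpace Ω] 
    (μ : Measure Ω) (f : Ω → ℝ) (hf : Integrable f μ) (r h C : ℝ) (ω : Ω)
    (h0 : 0 < h) (hh : h ≤ (μ (Metric.ball ω r)).toReal) (hC : ∫ ω, |f ω| ∂μ ≤ C) :
    |⨍ ω' in Metric.ball ω r, f ω' ∂μ| ≤ h⁻¹ * C := by
  rw [setAverage_eq, smul_eq_mul, abs_mul, abs_inv, abs_of_nonneg measureReal_nonneg]
  have : |∫ ω' in Metric.ball ω r, f ω' ∂μ| ≤ C :=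
    (abs_integral_le_integral_abs).trans ((setIntegral_le_integral hf.abs
      (ae_of_all _ fun _ => abs_nonneg _)).trans hC)
  have h3 : h ≤ μ.real (Metric.ball ω r) := hh
  gcongr

theorem aux_young (p x η : ℝ) (hp : 1 ≤ p) (hx : 0 ≤ x) (hη : 0 < η) :
    x ≤ η + η ^ (1 - p) * x ^ p := by
  rcases le_or_gt x η with h | h
  · have : 0 ≤ η ^ (1 - p) * x ^ p := by positivity
    linarith
  · have hx' : 0 < x := hη.trans h
    have h1 : x ^ (1 - p) ≤ η ^ (1 - p) :=
      Real.rpow_le_rpow_of_nonpos hη h.le (by linarith)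
    have h2 : x = x ^ (1 - p) * x ^ p := by
      rw [← Real.rpow_add hx']; simp
    have : x ^ (1 - p) * x ^ p ≤ η ^ (1 - p) * x ^ p := by gcongr
    linarith

theorem aux_int_young {Ω : Type*} [MeasurableSpace Ω]
    (μ : Measure Ω) [IsFiniteMeasure μ] (p η : ℝ) (hp : 1 ≤ p) (hη : 0 < η) (u : Ω → ℝ)
    (hu : Measurable u) (hi : Integrable (fun ω => |u ω| ^ p) μ) :
    Integrable u μ ∧ ∫ ω, |u ω| ∂μ ≤ η * μ.real univ + η ^ (1 - p) * ∫ ω, |u ω| ^ p ∂μ := by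
  have hI : Integrable (fun ω => η + η ^ (1 - p) * |u ω| ^ p) μ :=
    (integrable_const _).add (hi.const_mul _)
  have h1 : Integrable u μ := hI.mono' hu.aestronglyMeasurable
    (ae_of_all _ fun ω => aux_young p _ η hp (abs_nonneg _) hη)
  refine ⟨h1, ?_⟩
  calc _ ≤ ∫ ω, (η + η ^ (1 - p) * |u ω| ^ p) ∂μ :=
        integral_mono h1.abs hI fun ω => aux_young p _ η hp (abs_nonneg _) hη
    _ = _ := by
        rw [integral_add (integrable_const _) (hi.const_mul _), integral_const_mul]
        simp [mul_comm]

theorem aux_dist {Ω : Type*} [MeasurableSpace Ω]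
    (μ : Measure Ω) (p : ℝ) (hp : 1 ≤ p) [Fact (1 ≤ ENNReal.ofReal p)] (u v : Ω → ℝ)
    (hu : MemLp u (ENNReal.ofReal p) μ) (hv : MemLp v (ENNReal.ofReal p) μ) :
    dist (hu.toLp u) (hv.toLp v) = (∫ ω, |u ω - v ω| ^ p ∂μ) ^ (1 / p) := by
  rw [dist_eq_norm, ← MemLp.toLp_sub, Lp.norm_toLp,
    (hu.sub hv).eLpNorm_eq_integral_rpow_norm (by simp; linarith) (by simp),
    ENNReal.toReal_ofReal (by positivity), ENNReal.toReal_ofReal (by linarith)]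
  simp

theorem aux_memLp {Ω : Type*} [MeasurableSpace Ω]
    (μ : Measure Ω) (p : ℝ) (hp : 1 ≤ p) (u : Ω → ℝ) (hu : Measurable u) :
    Integrable (fun ω => |u ω| ^ p) μ ↔ MemLp u (ENNReal.ofReal p) μ := by
  rw [← integrable_norm_rpow_iff hu.aestronglyMeasurable (by simp; linarith) (by simp),
    ENNReal.toReal_ofReal (by linarith)]
  rfl

theorem aux_symm {Ω : Type*} [MeasurableSpace Ω]
    (μ : Measure Ω) (u : Ω → ℝ) (hu : Integrable u μ) (E D : Set Ω)
    (hE : MeasurableSet E) (hD : MeasurableSet D) :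
    |∫ ω in E, u ω ∂μ - ∫ ω in D, u ω ∂μ| ≤ ∫ ω in symmDiff E D, |u ω| ∂μ := by
  rw [← integral_indicator hE, ← integral_indicator hD, ← integral_indicator (hE.symmDiff hD),
    ← integral_sub (hu.indicator hE) (hu.indicator hD)]
  refine abs_integral_le_integral_abs.trans (integral_mono
    ((hu.indicator hE).sub (hu.indicator hD)).abs (hu.abs.indicator (hE.symmDiff hD)) fun ω => ?_)
  by_cases h1 : ω ∈ E <;> by_cases h2 : ω ∈ D <;> simp [h1, h2, mem_symmDiff]

theorem aux_ui {Ω : Type*} [MetricSpace Ω] [MeasurableSpace Ω] [BorelSpace Ω]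
    [SecondCountableTopology Ω]
    (μ : Measure Ω) [IsFiniteMeasure μ]
    (hμ : ∀ r : ℝ, 0 < r → ∃ h > 0, ∀ ω : Ω, h ≤ (μ (Metric.ball ω r)).toReal)
    (p : ℝ) (hp : 1 ≤ p) (f : ℕ → Ω → ℝ)
    (hmeas : ∀ k, Measurable (f k)) (hint : ∀ k, Integrable (f k) μ)
    (C : ℝ) (hC : ∀ k, ∫ ω, |f k ω| ∂μ ≤ C)
    (hosci : ∀ r, 0 < r → ∀ k,
      Integrable (fun ω => |f k ω - ⨍ ω' in Metric.ball ω r, f k ω' ∂μ| ^ p) μ)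
    (hosc : ∀ ε > 0, ∃ δ > 0, ∀ r : ℝ, 0 < r → r < δ → ∀ k,
      ∫ ω, |f k ω - ⨍ ω' in Metric.ball ω r, f k ω' ∂μ| ^ p ∂μ < ε) (ε : ℝ) (hε : 0 < ε) :
    ∃ δ > 0, ∀ E, MeasurableSet E → μ.real E < δ → ∀ k, ∫ ω in E, |f k ω| ∂μ ≤ ε := by
  have hC0 : 0 ≤ C := (integral_nonneg fun ω => abs_nonneg _).trans (hC 0)
  set m := μ.real univ with hm
  have hm0 : 0 ≤ m := measureReal_nonneg
  set η := ε / (3 * (m + 1)) with hη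
  have hη0 : 0 < η := by positivity
  have hηm : η * m ≤ ε / 3 := by
    rw [hη, div_mul_eq_mul_div, div_le_div_iff₀ (by positivity) (by positivity)]
    nlinarith
  have hq : 0 < η ^ (1 - p) := by positivity
  obtain ⟨r0, hr0, hr⟩ := hosc (ε / 3 / η ^ (1 - p)) (by positivity)
  obtain ⟨h, h0, hh⟩ := hμ (r0 / 2) (by positivity)
  refine ⟨ε / 3 / (h⁻¹ * C + 1), by positivity, fun E hE hEm k => ?_⟩
  have hr' := hr (r0 / 2) (by positivity) (by linarith) k
  have hA : Measurable (fun ω => ⨍ ω' in Metric.ball ω (r0 / 2), f k ω' ∂μ) :=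
    aux_avg_meas μ (f k) (hmeas k) _
  obtain ⟨hy1, hy2⟩ := aux_int_young μ p η hp hη0
    (fun ω => f k ω - ⨍ ω' in Metric.ball ω (r0 / 2), f k ω' ∂μ)
    ((hmeas k).sub hA) (hosci _ (by positivity) k)
  have hb : ∀ ω, |⨍ ω' in Metric.ball ω (r0 / 2), f k ω' ∂μ| ≤ h⁻¹ * C := fun ω =>
    aux_avg_bdd μ (f k) (hint k) _ h C ω h0 (hh ω) (hC k)
  have h1 : ∫ ω in E, |f k ω| ∂μ ≤ ∫ ω in E,
      (|f k ω - ⨍ ω' in Metric.ball ω (r0 / 2), f k ω' ∂μ| + h⁻¹ * C) ∂μ := by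
    refine integral_mono (hint k).abs.integrableOn
      (hy1.abs.integrableOn.add (integrable_const _)) fun ω => ?_
    have := abs_add_le (f k ω - ⨍ ω' in Metric.ball ω (r0 / 2), f k ω' ∂μ)
      (⨍ ω' in Metric.ball ω (r0 / 2), f k ω' ∂μ)
    rw [sub_add_cancel] at this
    linarith [hb ω]
  rw [integral_add hy1.abs.integrableOn (integrable_const _)] at h1
  have h2 := setIntegral_le_integral (s := E) hy1.abs (ae_of_all _ fun _ => abs_nonneg _)
  have h3 : η ^ (1 - p) * ∫ ω, |f k ω - ⨍ ω' in Metric.ball ω (r0 / 2), f k ω' ∂μ| ^ p ∂μ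
      ≤ ε / 3 := by
    rw [lt_div_iff₀ hq] at hr'
    linarith
  have h4 : ∫ ω in E, h⁻¹ * C ∂μ ≤ ε / 3 := by
    rw [lt_div_iff₀ (by positivity)] at hEm
    simp only [integral_const, smul_eq_mul, measureReal_restrict_apply_univ]
    have : 0 ≤ μ.real E := measureReal_nonneg
    nlinarith
  linarith

theorem aux_subseq {Ω : Type*} [MeasurableSpace Ω] [MeasurableSpace.CountablyGenerated Ω]
    (μ : Measure Ω) [IsFiniteMeasure μ] (f : ℕ → Ω → ℝ) (hint : ∀ k, Integrable (f k) μ)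
    (C : ℝ) (hC : ∀ k, ∫ ω, |f k ω| ∂μ ≤ C)
    (hui : ∀ ε > 0, ∃ δ > 0, ∀ E, MeasurableSet E → μ.real E < δ →
      ∀ k, ∫ ω in E, |f k ω| ∂μ ≤ ε) :
    ∃ χ : ℕ → ℕ, StrictMono χ ∧ ∀ E, MeasurableSet E →
      ∃ a, Tendsto (fun j => ∫ ω in E, f (χ j) ω ∂μ) atTop (nhds a) := by
  obtain ⟨A, hA, hd⟩ := exists_countable_measureDense μ
  have : Countable A := hA.to_subtype
  let x : ℕ → (A → ℝ) := fun k D => ∫ ω in (D : Set Ω), f k ω ∂μ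
  have hK : IsCompact (Set.pi univ (fun _ : A => Icc (-C) C)) :=
    isCompact_univ_pi fun _ => isCompact_Icc
  obtain ⟨a, -, χ, hχ, ht⟩ := hK.tendsto_subseq (x := x) (by
    intro k D _
    refine abs_le.1 (?_ : |x k D| ≤ C)
    exact (abs_integral_le_integral_abs).trans ((setIntegral_le_integral (hint k).abs
      (ae_of_all _ fun _ => abs_nonneg _)).trans (hC k)))
  refine ⟨χ, hχ, fun E hE => ?_⟩
  apply cauchySeq_tendsto_of_complete
  rw [Metric.cauchySeq_iff']
  intro ε hε
  obtain ⟨δ, hδ, hu⟩ := hui (ε / 4) (by positivity)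
  obtain ⟨D, hD, hED⟩ := hd.approx E hE (measure_ne_top _ _) δ hδ
  have hDm := hd.measurable D hD
  have hED' : μ.real (symmDiff E D) < δ :=
    (ENNReal.lt_ofReal_iff_toReal_lt (measure_ne_top _ _)).1 hED
  have hcl : ∀ k, |∫ ω in E, f k ω ∂μ - ∫ ω in D, f k ω ∂μ| ≤ ε / 4 := fun k =>
    (aux_symm μ (f k) (hint k) E D hE hDm).trans (hu _ (hE.symmDiff hDm) hED' k)
  have htD : Tendsto (fun j => ∫ ω in D, f (χ j) ω ∂μ) atTop (nhds (a ⟨D, hD⟩)) :=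
    (tendsto_pi_nhds.1 ht) ⟨D, hD⟩
  obtain ⟨N, hN⟩ := Metric.cauchySeq_iff'.1 htD.cauchySeq (ε / 4) (by positivity)
  refine ⟨N, fun n hn => ?_⟩
  have h1 := hN n hn
  have h2 := hcl (χ n)
  have h3 := hcl (χ N)
  rw [Real.dist_eq] at h1 ⊢
  rw [abs_lt] at h1 ⊢
  rw [abs_le] at h2 h3
  constructor <;> linarith [h1.1, h1.2, h2.1, h2.2, h3.1, h3.2]

theorem aux_core {Ω : Type*} [MetricSpace Ω] [MeasurableSpace Ω] [BorelSpace Ω]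
    (μ : Measure Ω) [IsFiniteMeasure μ]
    (hμ : ∀ r : ℝ, 0 < r → ∃ h > 0, ∀ ω : Ω, h ≤ (μ (Metric.ball ω r)).toReal)
    (p : ℝ) (hp : 1 ≤ p)
    (f : ℕ → Ω → ℝ)
    (hmeas : ∀ k, Measurable (f k)) (hfi : ∀ k, Integrable (fun ω => |f k ω| ^ p) μ)
    (M : ℝ) (hbdd : ∀ k, ∫ ω, |f k ω| ^ p ∂μ ≤ M)
    (hosc : ∀ ε > 0, ∃ δ > 0, ∀ r : ℝ, 0 < r → r < δ → ∀ k,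
      ∫ ω, |f k ω - ⨍ ω' in Metric.ball ω r, f k ω' ∂μ| ^ p ∂μ < ε) :
      ∃ χ : ℕ → ℕ, StrictMono χ ∧
        ∃ flim : Ω → ℝ, Integrable (fun ω => |flim ω| ^ p) μ ∧
          Tendsto (fun j => ∫ ω, |f (χ j) ω - flim ω| ^ p ∂μ) atTop (nhds 0) := by
  have hsc := aux_sc μ hμ
  have hfact : Fact (1 ≤ ENNReal.ofReal p) := ⟨by simpa using hp⟩
  have hp0 : 0 < p := by linarith
  have hint : ∀ k, Integrable (f k) μ := fun k =>
    (aux_int_young μ p 1 hp one_pos _ (hmeas k) (hfi k)).1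
  have hC : ∀ k, ∫ ω, |f k ω| ∂μ ≤ μ.real univ + M := fun k => by
    have := (aux_int_young μ p 1 hp one_pos _ (hmeas k) (hfi k)).2
    simp only [Real.one_rpow, one_mul] at this
    linarith [hbdd k]
  have hL : ∀ k, MemLp (f k) (ENNReal.ofReal p) μ := fun k =>
    (aux_memLp μ p hp _ (hmeas k)).1 (hfi k)
  have hAm := fun r k => aux_avg_meas μ (f k) (hmeas k) r
  have hAL : ∀ r, 0 < r → ∀ k,
      MemLp (fun ω => ⨍ ω' in Metric.ball ω r, f k ω' ∂μ) (ENNReal.ofReal p) μ := by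
    intro r hr k
    obtain ⟨h, h0, hh⟩ := hμ r hr
    exact MemLp.of_bound (hAm r k).aestronglyMeasurable (h⁻¹ * (μ.real univ + M))
      (ae_of_all _ fun ω => aux_avg_bdd μ (f k) (hint k) _ h _ ω h0 (hh ω) (hC k))
  have hosci : ∀ r, 0 < r → ∀ k,
      Integrable (fun ω => |f k ω - ⨍ ω' in Metric.ball ω r, f k ω' ∂μ| ^ p) μ := fun r hr k =>
    (aux_memLp μ p hp _ ((hmeas k).sub (hAm r k))).2 ((hL k).sub (hAL r hr k))
  obtain ⟨χ, hχ, hconv⟩ := aux_subseq μ f hint _ hC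
    (aux_ui μ hμ p hp f hmeas hint _ hC hosci hosc)
  refine ⟨χ, hχ, ?_⟩
  have hcau : CauchySeq (fun j => (hL (χ j)).toLp (f (χ j))) := by
    rw [Metric.cauchySeq_iff']
    intro ε hε
    obtain ⟨δ, hδ, hd⟩ := hosc ((ε / 3) ^ p) (by positivity)
    have hr : 0 < δ / 2 := by positivity
    set r := δ / 2 with hrdef
    have hclose : ∀ k, dist ((hL k).toLp (f k)) ((hAL r hr k).toLp _) < ε / 3 := by
      intro k
      rw [aux_dist μ p hp]
      have := hd r hr (by linarith) k
      calc _ < ((ε / 3) ^ p) ^ (1 / p) :=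
            Real.rpow_lt_rpow (integral_nonneg fun _ => by positivity) this (by positivity)
        _ = ε / 3 := by
            rw [← Real.rpow_mul (by positivity), mul_one_div_cancel hp0.ne', Real.rpow_one]
    obtain ⟨h, h0, hh⟩ := hμ r hr
    have hb : ∀ k ω, |⨍ ω' in Metric.ball ω r, f k ω' ∂μ| ≤ h⁻¹ * (μ.real univ + M) :=
      fun k ω => aux_avg_bdd μ (f k) (hint k) _ h _ ω h0 (hh ω) (hC k)
    have hpt : ∀ ω, ∃ a, Tendsto (fun j => ⨍ ω' in Metric.ball ω r, f (χ j) ω' ∂μ)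
        atTop (nhds a) := by
      intro ω
      obtain ⟨a, ha⟩ := hconv _ (Metric.isOpen_ball (x := ω) (ε := r)).measurableSet
      simp_rw [setAverage_eq]
      exact ⟨_, ha.const_smul _⟩
    choose G hG using hpt
    have hGm : Measurable G := measurable_of_tendsto_metrizable (fun j => hAm r (χ j))
      (tendsto_pi_nhds.2 hG)
    have hGb : ∀ ω, |G ω| ≤ h⁻¹ * (μ.real univ + M) := fun ω =>
      le_of_tendsto (hG ω).abs (Eventually.of_forall fun j => hb _ ω)
    have hGL : MemLp G (ENNReal.ofReal p) μ :=
      MemLp.of_bound hGm.aestronglyMeasurable _ (ae_of_all _ hGb)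
    have hdom : Tendsto (fun j => ∫ ω, |(⨍ ω' in Metric.ball ω r, f (χ j) ω' ∂μ) - G ω| ^ p ∂μ)
        atTop (nhds (∫ ω, (0 : ℝ) ∂μ)) := by
      refine tendsto_integral_of_dominated_convergence
        (fun _ => (2 * (h⁻¹ * (μ.real univ + M))) ^ p) (fun j => ?_) (integrable_const _)
        (fun j => ae_of_all _ fun ω => ?_) (ae_of_all _ fun ω => ?_)
      · exact (((hAm r (χ j)).sub hGm).abs.pow_const p).aestronglyMeasurable
      · rw [Real.norm_eq_abs, abs_of_nonneg (by positivity)]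
        refine Real.rpow_le_rpow (abs_nonneg _) ?_ hp0.le
        refine (abs_sub _ _).trans ?_
        linarith [hb (χ j) ω, hGb ω]
      · have h1 : Tendsto (fun j => |(⨍ ω' in Metric.ball ω r, f (χ j) ω' ∂μ) - G ω| ^ p)
            atTop (nhds (|G ω - G ω| ^ p)) :=
          ((hG ω).sub_const _).abs.rpow_const (Or.inr hp0.le)
        simpa [hp0.ne'] using h1
    have hAt : Tendsto (fun j => (hAL r hr (χ j)).toLp _) atTop (nhds (hGL.toLp G)) := by
      rw [tendsto_iff_dist_tendsto_zero]
      simp_rw [aux_dist μ p hp]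
      have := hdom.rpow_const (p := 1 / p) (Or.inr (by positivity))
      simpa [hp0.ne'] using this
    obtain ⟨N, hN⟩ := Metric.cauchySeq_iff'.1 hAt.cauchySeq (ε / 3) (by positivity)
    refine ⟨N, fun n hn => ?_⟩
    have h1 := hN n hn
    have h2 := hclose (χ n)
    have h3 := hclose (χ N)
    rw [dist_comm] at h3
    refine (dist_triangle4 _ _ _ _).trans_lt (lt_of_lt_of_le (add_lt_add (add_lt_add h2 h1) h3) ?_)
    linarith
  obtain ⟨F, hF⟩ := cauchySeq_tendsto_of_complete hcau
  have hFL := Lp.memLp F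
  have hFm : Measurable (F : Ω → ℝ) := (Lp.stronglyMeasurable F).measurable
  refine ⟨F, (aux_memLp μ p hp _ hFm).2 hFL, ?_⟩
  have hF' : hFL.toLp (F : Ω → ℝ) = F := Lp.toLp_coeFn F hFL
  rw [← hF', tendsto_iff_dist_tendsto_zero] at hF
  simp_rw [aux_dist μ p hp] at hF
  have h1 := hF.rpow_const (p := p) (Or.inr hp0.le)
  rw [Real.zero_rpow hp0.ne'] at h1
  refine h1.congr fun j => ?_
  rw [← Real.rpow_mul (integral_nonneg fun _ => by positivity), one_div_mul_cancel hp0.ne',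
    Real.rpow_one]



/-- Rellich–Kondrachov-type criterion: if `Ω` is a metric space with a
finite Borel measure `μ` such that `inf_ω μ(B_r(ω)) > 0` for every `r > 0`, then every
bounded sequence `{f_k} ⊂ L^p(μ,Ω)` (`1 ≤ p < ∞`) whose oscillation around ball
averages tends to `0` uniformly in `k` as the radius `r → 0` is relatively compact in
`L^p(μ,Ω)` (here: every subsequence admits a further subsequence converging in the
`L^p` distance to some `L^p` function). -/
theorem stmt_5 {Ω : Type*} [MetricSpace Ω] [MeasurableSpace Ω] [BorelSpace Ω]
    (μ : Measure Ω) [IsFiniteMeasure μ]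
    (hμ : ∀ r : ℝ, 0 < r → ∃ h > 0, ∀ ω : Ω, h ≤ (μ (Metric.ball ω r)).toReal)
    (p : ℝ) (hp : 1 ≤ p)
    (f : ℕ → Ω → ℝ)
    (hmeas : ∀ k, Measurable (f k))
    (hbdd : ∃ M : ℝ, ∀ k, ∫ ω, |f k ω| ^ p ∂μ ≤ M)
    (hosc : ∀ ε > 0, ∃ δ > 0, ∀ r : ℝ, 0 < r → r < δ → ∀ k,
      ∫ ω, |f k ω - ⨍ ω' in Metric.ball ω r, f k ω' ∂μ| ^ p ∂μ < ε) :
    ∀ ψ : ℕ → ℕ, StrictMono ψ →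
      ∃ χ : ℕ → ℕ, StrictMono χ ∧
        ∃ flim : Ω → ℝ, Integrable (fun ω => |flim ω| ^ p) μ ∧
          Tendsto (fun j => ∫ ω, |f (ψ (χ j)) ω - flim ω| ^ p ∂μ) atTop (nhds 0) := by

  intro ψ hψ
  obtain ⟨M, hM⟩ := hbdd
  by_cases hfr : ∃ᶠ j in atTop, ¬ Integrable (fun ω => |f (ψ j) ω| ^ p) μ
  · obtain ⟨χ, hχ, hn⟩ := extraction_of_frequently_atTop hfr
    refine ⟨χ, hχ, 0, ?_, ?_⟩
    · have hp0 : p ≠ 0 := by linarith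
      simp [hp0]
    · refine tendsto_const_nhds.congr fun j => ?_
      symm
      simpa using integral_undef (hn j)
  · rw [not_frequently] at hfr
    simp only [not_not] at hfr
    obtain ⟨N, hN⟩ := eventually_atTop.1 hfr
    obtain ⟨χ, hχ, flim, h1, h2⟩ := aux_core μ hμ p hp (fun j => f (ψ (N + j)))
      (fun k => hmeas _) (fun k => hN _ (by omega)) M (fun k => hM _) (fun ε hε => by
        obtain ⟨δ, hδ, h⟩ := hosc ε hε
        exact ⟨δ, hδ, fun r h0 hr k => h r h0 hr _⟩)
    exact ⟨fun j => N + χ j, fun a b hab => Nat.add_lt_add_left (hχ hab) N, flim, h1, h2⟩
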